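/- The Lie algebra 𝔤₂ = {T(a,b) | a, b ∈ ℍ, Re a = 0, Re b = 0} is a Berger algebra: the endomorphisms R(u, v), for R an algebraic curvature tensor of type 𝔤₂ and u, v ∈ V, span 𝔤₂ over ℝ. -/

import Mathlib

open Quaternion

noncomputable section

/-- `V = ℍ × ℍ`, the pseudo-quaternionic-Hermitian space `ℍ^{1,1}` in an isotropic basis
`p = (1,0)`, `q = (0,1)`. -/
abbrev V : Type := ℍ[ℝ] × ℍ[ℝ]

/-- The neutral-signature metric `η((x,y),(x',y')) = Re(x conj(y') + y conj(x'))`. -/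
def η (u v : V) : ℝ := (u.1 * star v.2 + u.2 * star v.1).re

/-- The endomorphism of `ℍ^{1,1}` with matrix `[[a, b], [0, -conj a]]` in the isotropic
basis `(p, q)`: `T(a,b)(x,y) = (x a + y b, − y conj(a))`. -/
def T (a b : ℍ[ℝ]) : Module.End ℝ V where
  toFun u := (u.1 * a + u.2 * b, -(u.2 * star a))
  map_add' u v := by
    simp only [Prod.fst_add, Prod.snd_add, add_mul, Prod.mk_add_mk, Prod.mk.injEq]
    constructor <;> abel
  map_smul' r u := by
    simp only [Prod.smul_fst, Prod.smul_snd, RingHom.id_apply, Prod.smul_mk,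
      smul_mul_assoc, smul_add, smul_neg]

/-- `R` is an algebraic curvature tensor of type `g`: a bilinear alternating map
`V × V → End_ℝ(V)` with values in `g` satisfying the first Bianchi identity. -/
def IsCurv (g : Set (Module.End ℝ V)) (R : V →ₗ[ℝ] V →ₗ[ℝ] Module.End ℝ V) : Prop :=
  (∀ u v : V, R u v = - R v u) ∧ (∀ u v : V, R u v ∈ g) ∧
  (∀ u v w : V, R u v w + R v w u + R w u v = 0)

/-- The Lie algebra `𝔤₂ = {T(a,b) | a, b ∈ Im ℍ}`. -/
def g : Set (Module.End ℝ V) := {f | ∃ a b : ℍ[ℝ], a.re = 0 ∧ b.re = 0 ∧ f = T a b}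

theorem T_add (a a' b b' : ℍ[ℝ]) : T (a + a') (b + b') = T a b + T a' b' := by
  refine LinearMap.ext fun w => Prod.ext ?_ ?_
  · simp only [T, LinearMap.coe_mk, AddHom.coe_mk, LinearMap.add_apply, Prod.fst_add, mul_add]
    abel
  · simp only [T, LinearMap.coe_mk, AddHom.coe_mk, LinearMap.add_apply, Prod.snd_add, star_add,
      mul_add]
    abel

theorem T_smul (r : ℝ) (a b : ℍ[ℝ]) : T (r • a) (r • b) = r • T a b := by
  refine LinearMap.ext fun w => Prod.ext ?_ ?_ <;>
    simp [T]

theorem T_neg (a b : ℍ[ℝ]) : T (-a) (-b) = -T a b := by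
  rw [← neg_one_smul ℝ a, ← neg_one_smul ℝ b, T_smul]
  exact neg_one_smul ℝ (T a b)

/-- The linear map `diag(1, 1, -2)` on imaginary parts: it is trace-free and symmetric, and so
represents a Weyl tensor of type `sp(1)` on `ℍ`. -/
def weylDiag : ℍ[ℝ] →ₗ[ℝ] ℍ[ℝ] where
  toFun m := ⟨0, m.imI, m.imJ, -2 * m.imK⟩
  map_add' m n := Quaternion.ext _ _ (add_zero 0).symm rfl rfl (mul_add (-2) m.imK n.imK)
  map_smul' r m := Quaternion.ext _ _ (mul_zero r).symm rfl rfl (mul_left_comm (-2) r m.imK)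

@[simp] theorem re_weylDiag (m : ℍ[ℝ]) : (weylDiag m).re = 0 := rfl

@[simp] theorem imI_weylDiag (m : ℍ[ℝ]) : (weylDiag m).imI = m.imI := rfl

@[simp] theorem imJ_weylDiag (m : ℍ[ℝ]) : (weylDiag m).imJ = m.imJ := rfl

@[simp] theorem imK_weylDiag (m : ℍ[ℝ]) : (weylDiag m).imK = -2 * m.imK := rfl

theorem star_weylDiag (m : ℍ[ℝ]) : star (weylDiag m) = -weylDiag m := by
  ext <;> simp

theorem weylDiag_star (m : ℍ[ℝ]) : weylDiag (star m) = -weylDiag m := by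
  ext <;> simp

theorem exists_weylDiag_eq (a : ℍ[ℝ]) (ha : a.re = 0) : ∃ m, weylDiag m = a :=
  ⟨⟨0, a.imI, a.imJ, -a.imK / 2⟩, Quaternion.ext _ _ ha.symm rfl rfl
    (show -2 * (-a.imK / 2) = a.imK by ring)⟩

theorem weylDiag_bianchi (x y z : ℍ[ℝ]) :
    z * weylDiag (star x * y) + x * weylDiag (star y * z) + y * weylDiag (star z * x) = 0 := by
  ext <;> simp <;> ring

/-- The `ℝ[ε]`-bilinear extension to `V = ℍ ⊗ ℝ[ε]` of the Weyl tensor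
`(u, v) ↦ weylDiag (conj u * v)`. -/
def weylCurv : V →ₗ[ℝ] V →ₗ[ℝ] Module.End ℝ V :=
  LinearMap.mk₂ ℝ
    (fun u v => T (weylDiag (star u.2 * v.2)) (weylDiag (star u.1 * v.2 + star u.2 * v.1)))
    (fun u u' v => by
      rw [← T_add, ← map_add, ← map_add]
      simp only [Prod.fst_add, Prod.snd_add, star_add, add_mul]
      congr 2
      abel)
    (fun r u v => by
      rw [← T_smul, ← map_smul, ← map_smul]
      simp)
    (fun u v v' => by
      rw [← T_add, ← map_add, ← map_add]
      simp only [Prod.fst_add, Prod.snd_add, mul_add]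
      congr 2
      abel)
    (fun r u v => by
      rw [← T_smul, ← map_smul, ← map_smul]
      simp)

theorem weylCurv_apply (u v : V) : weylCurv u v =
    T (weylDiag (star u.2 * v.2)) (weylDiag (star u.1 * v.2 + star u.2 * v.1)) := rfl

theorem weylCurv_apply_apply (u v w : V) : weylCurv u v w =
    (w.1 * weylDiag (star u.2 * v.2) +
      w.2 * (weylDiag (star u.1 * v.2) + weylDiag (star u.2 * v.1)),
      w.2 * weylDiag (star u.2 * v.2)) := by
  simp [weylCurv_apply, T, star_weylDiag]

theorem isCurv_weylCurv : IsCurv g weylCurv := by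
  refine ⟨fun u v => ?_, fun u v => ⟨_, _, rfl, rfl, weylCurv_apply u v⟩, fun u v w => ?_⟩
  · rw [weylCurv_apply, weylCurv_apply, ← T_neg, ← weylDiag_star, ← weylDiag_star]
    simp only [star_add, star_mul, star_star]
    rw [add_comm]
  · simp only [weylCurv_apply_apply]
    refine Prod.ext ?_ (weylDiag_bianchi u.2 v.2 w.2)
    have h := congrArg₂ (· + ·) (congrArg₂ (· + ·) (weylDiag_bianchi u.1 v.2 w.2)
      (weylDiag_bianchi u.2 v.1 w.2)) (weylDiag_bianchi u.2 v.2 w.1)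
    simp only [add_zero] at h
    simp only [Prod.fst_add, Prod.fst_zero]
    rw [← h]
    noncomm_ring

theorem exists_weylCurv_eq (a b : ℍ[ℝ]) (ha : a.re = 0) (hb : b.re = 0) :
    ∃ u v : V, T a b = weylCurv u v := by
  obtain ⟨m, rfl⟩ := exists_weylDiag_eq a ha
  obtain ⟨n, rfl⟩ := exists_weylDiag_eq b hb
  exact ⟨(0, 1), (n, m), by simp [weylCurv_apply]⟩

/-- this Lie algebra is a Berger algebra: the endomorphisms `R u v`, for
`R` an algebraic curvature tensor of type the algebra and `u, v ∈ V`, span it over ℝ. -/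
theorem g2_is_berger_algebra :
    Submodule.span ℝ {f : Module.End ℝ V |
        ∃ R : V →ₗ[ℝ] V →ₗ[ℝ] Module.End ℝ V, IsCurv g R ∧ ∃ u v : V, f = R u v}
      = Submodule.span ℝ g := by
  congr 1
  ext f
  constructor
  · rintro ⟨R, hR, u, v, rfl⟩
    exact hR.2.1 u v
  · rintro ⟨a, b, ha, hb, rfl⟩
    exact ⟨weylCurv, isCurv_weylCurv, exists_weylCurv_eq a b ha hb⟩

end
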